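/- arXiv:1001.5302 — 4 statements merged into one kernel-verified Lean document; each statement's English description precedes it below -/
import Mathlib

section
/- Let k be a field of characteristic different from 2 and 3, let F ∈ k[x,y,z] be a ternary cubic form, and define the Caylean determinant D(F) := det of the 3×3 matrix whose rows are (∂F/∂x, ∂F/∂y, ∂F/∂z) evaluated respectively at (0,z,−y), (−z,0,x), and (y,−x,0). Then for every M ∈ GL₃(k) with d := det M, the following polynomial identity holds in k[x,y,z]: (xyz ∘ M⁻ᵀ) · D(F ∘ M) = d⁴ · xyz · (D(F) ∘ M⁻ᵀ), where M⁻ᵀ is the inverse transpose of M. (Equivalently, the Caylean P(F) := −D(F)/(xyz) depends contravariantly of weight 4 on F: P(F ∘ M) = d⁴ · P(F) ∘ M⁻ᵀ.) -/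
open MvPolynomial Matrix

noncomputable section

/-- The right action of a matrix on ternary forms by linear substitution of variables:
`(F ∘ M)(v) = F(M v)`. -/
def compMat {k : Type*} [Field k] (F : MvPolynomial (Fin 3) k)
    (M : Matrix (Fin 3) (Fin 3) k) : MvPolynomial (Fin 3) k :=
  aeval (fun i : Fin 3 => ∑ j : Fin 3, C (M i j) * X j) F

/-- The Caylean determinant of a ternary cubic form `F`: the determinant of the 3×3 matrix
whose rows are the gradient `(∂F/∂x, ∂F/∂y, ∂F/∂z)` evaluated at `(0,z,-y)`, `(-z,0,x)`,
`(y,-x,0)` respectively. -/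
def cayleanDet {k : Type*} [Field k] (F : MvPolynomial (Fin 3) k) : MvPolynomial (Fin 3) k :=
  (Matrix.of fun i j : Fin 3 =>
    aeval (![![0, X 2, -X 1], ![-X 2, 0, X 0], ![X 1, -X 0, 0]] i) (pderiv j F)).det

/-- Quadratic expansion of a homogeneous polynomial of degree two. -/
theorem quad_expand {k R : Type*} [Field k] [CommRing R] [Algebra k R]
    (Q : MvPolynomial (Fin 3) k) (hQ : Q.IsHomogeneous 2) (p q : Fin 3 → R) :
    ∃ B : R, ∀ s t : R, aeval (fun i => s * p i + t * q i) Q =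
      s ^ 2 * aeval p Q + s * t * B + t ^ 2 * aeval q Q := by
  have key : ∀ S : Finset (Fin 3 →₀ ℕ), (∀ e ∈ S, e.degree = 2) →
      ∃ B : R, ∀ s t : R,
        aeval (fun i => s * p i + t * q i) (∑ e ∈ S, monomial e (coeff e Q)) =
        s ^ 2 * aeval p (∑ e ∈ S, monomial e (coeff e Q)) + s * t * B
          + t ^ 2 * aeval q (∑ e ∈ S, monomial e (coeff e Q)) := by
    intro S
    induction S using Finset.induction_on with
    | empty => intro _; exact ⟨0, fun s t => by simp⟩
    | insert e S he ih =>
      intro hS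
      obtain ⟨B, hB⟩ := ih (fun e' h' => hS e' (Finset.mem_insert_of_mem h'))
      have hd := hS e (Finset.mem_insert_self _ _)
      have h1 : ∃ B : R, ∀ s t : R,
          aeval (fun i => s * p i + t * q i) (monomial e (coeff e Q)) =
          s ^ 2 * aeval p (monomial e (coeff e Q)) + s * t * B
          + t ^ 2 * aeval q (monomial e (coeff e Q)) := by
        have hd' : e 0 + e 1 + e 2 = 2 := by
          rw [Finsupp.degree_eq_sum, Fin.sum_univ_three] at hd
          exact hd
        have ev : ∀ f : Fin 3 → R, aeval f (monomial e (coeff e Q)) =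
            algebraMap k R (coeff e Q) * (f 0 ^ e 0 * f 1 ^ e 1 * f 2 ^ e 2) := by
          intro f
          rw [aeval_monomial, Finsupp.prod_fintype _ _ (by simp), Fin.prod_univ_three]
        simp only [ev]
        generalize algebraMap k R (coeff e Q) = c
        have h0 : e 0 ≤ 2 := by omega
        have h1 : e 1 ≤ 2 := by omega
        have h2 : e 2 = 2 - e 0 - e 1 := by omega
        rw [h2]
        generalize e 0 = a at *
        generalize e 1 = b at *
        interval_cases a <;> interval_cases b <;> first
          | omega
          | (refine ⟨c * (2 * p 2 * q 2), fun s t => ?_⟩; simp; ring1)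
          | (refine ⟨c * (2 * p 1 * q 1), fun s t => ?_⟩; simp; ring1)
          | (refine ⟨c * (2 * p 0 * q 0), fun s t => ?_⟩; simp; ring1)
          | (refine ⟨c * (p 0 * q 1 + p 1 * q 0), fun s t => ?_⟩; simp; ring1)
          | (refine ⟨c * (p 0 * q 2 + p 2 * q 0), fun s t => ?_⟩; simp; ring1)
          | (refine ⟨c * (p 1 * q 2 + p 2 * q 1), fun s t => ?_⟩; simp; ring1)
      obtain ⟨B', hB'⟩ := h1
      refine ⟨B' + B, fun s t => ?_⟩
      simp only [Finset.sum_insert he, map_add, hB, hB']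
      ring
  have := key Q.support (fun e he => by
    have := hQ (mem_support_iff.mp he)
    rwa [Finsupp.degree_eq_weight_one])
  rwa [← Q.as_sum] at this

theorem quad_scale {k R : Type*} [Field k] [CommRing R] [Algebra k R]
    (Q : MvPolynomial (Fin 3) k) (hQ : Q.IsHomogeneous 2) (p : Fin 3 → R) (s : R) :
    aeval (fun i => s * p i) Q = s ^ 2 * aeval p Q := by
  obtain ⟨B, hB⟩ := quad_expand Q hQ p p
  simpa using hB s 0

/-- Cross product. -/
def crs {R : Type*} [CommRing R] (w n : Fin 3 → R) : Fin 3 → R :=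
  ![w 1 * n 2 - w 2 * n 1, w 2 * n 0 - w 0 * n 2, w 0 * n 1 - w 1 * n 0]

/-- Triple product. -/
def trp {R : Type*} [CommRing R] (w a b : Fin 3 → R) : R :=
  w 0 * (a 1 * b 2 - a 2 * b 1) + w 1 * (a 2 * b 0 - a 0 * b 2) + w 2 * (a 0 * b 1 - a 1 * b 0)

theorem crs_det {k R : Type*} [Field k] [CommRing R] [IsDomain R] [Algebra k R]
    (G : Fin 3 → MvPolynomial (Fin 3) k) (hG : ∀ j, (G j).IsHomogeneous 2)
    (w : Fin 3 → R) (hw : w 0 ≠ 0) : ∃ K : R, ∀ n : Fin 3 → Fin 3 → R,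
    w 0 ^ 3 * (Matrix.of fun i j : Fin 3 => aeval (crs w (n i)) (G j)).det =
      trp w (n 1) (n 2) * trp w (n 2) (n 0) * trp w (n 0) (n 1) * K := by
  choose B hB using fun j => quad_expand (G j) (hG j) ![-w 2, 0, w 0] ![w 1, -w 0, 0]
  let P : Matrix (Fin 3) (Fin 3) R := Matrix.of
    ![fun j => aeval ![-w 2, 0, w 0] (G j), B, fun j => aeval ![w 1, -w 0, 0] (G j)]
  refine ⟨-P.det, fun n => ?_⟩
  let al : Fin 3 → R := fun i => w 0 * n i 1 - w 1 * n i 0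
  let be : Fin 3 → R := fun i => w 0 * n i 2 - w 2 * n i 0
  let V : Matrix (Fin 3) (Fin 3) R := Matrix.of
    fun i => ![al i ^ 2, al i * be i, be i ^ 2]
  have h1 : w 0 ^ 2 • (Matrix.of fun i j : Fin 3 => aeval (crs w (n i)) (G j)) = V * P := by
    ext i j
    have : (fun l => w 0 * crs w (n i) l) =
        fun l => al i * ![-w 2, 0, w 0] l + be i * ![w 1, -w 0, 0] l := by
      funext l
      fin_cases l <;> simp [crs, al, be] <;> ring
    simp only [Matrix.smul_apply, Matrix.of_apply, smul_eq_mul]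
    rw [← quad_scale _ (hG j), this, hB]
    simp [Matrix.mul_apply, Fin.sum_univ_three, V, P]
  have h2 := congrArg Matrix.det h1
  rw [Matrix.det_smul, Matrix.det_mul] at h2
  have h3 : V.det = -w 0 ^ 3 * (trp w (n 1) (n 2) * trp w (n 2) (n 0) * trp w (n 0) (n 1)) := by
    simp [Matrix.det_fin_three, V, al, be, trp]
    ring
  rw [h3] at h2
  apply mul_left_cancel₀ (pow_ne_zero 3 hw)
  simp only [Fintype.card_fin] at h2
  linear_combination h2

theorem crs_identity {k R : Type*} [Field k] [CommRing R] [IsDomain R] [Algebra k R]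
    (G : Fin 3 → MvPolynomial (Fin 3) k) (hG : ∀ j, (G j).IsHomogeneous 2)
    (w : Fin 3 → R) (hw : w 0 ≠ 0) (n : Fin 3 → Fin 3 → R) :
    w 0 * w 1 * w 2 * (Matrix.of fun i j : Fin 3 => aeval (crs w (n i)) (G j)).det =
      trp w (n 1) (n 2) * trp w (n 2) (n 0) * trp w (n 0) (n 1) *
      (Matrix.of fun i j : Fin 3 => aeval
        (![![0, w 2, -w 1], ![-w 2, 0, w 0], ![w 1, -w 0, 0]] i) (G j)).det := by
  obtain ⟨K, hK⟩ := crs_det G hG w hw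
  have h1 := hK n
  have h2 := hK ![![1, 0, 0], ![0, 1, 0], ![0, 0, 1]]
  have e : (fun i => crs w (![![1, 0, 0], ![0, 1, 0], ![0, 0, 1]] i)) =
      ![![0, w 2, -w 1], ![-w 2, 0, w 0], ![w 1, -w 0, 0]] := by
    funext i l
    fin_cases i <;> fin_cases l <;> simp [crs]
  have e' := fun i => congrFun e i
  simp only [e'] at h2
  have e3 : trp w (![![1, 0, 0], ![0, 1, 0], ![0, 0, 1]] 1) (![![1, 0, 0], ![0, 1, 0], ![0, 0, 1]] 2)
     * trp w (![![1, 0, 0], ![0, 1, 0], ![0, 0, 1]] 2) (![![1, 0, 0], ![0, 1, 0], ![0, 0, 1]] 0)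
     * trp w (![![1, 0, 0], ![0, 1, 0], ![0, 0, 1]] 0) (![![1, 0, 0], ![0, 1, 0], ![0, 0, 1]] 1)
     = w 0 * w 1 * w 2 := by
    simp [trp]
  rw [e3] at h2
  apply mul_left_cancel₀ (pow_ne_zero 3 hw)
  linear_combination (w 0 * w 1 * w 2) * h1 -
    (trp w (n 1) (n 2) * trp w (n 2) (n 0) * trp w (n 0) (n 1)) * h2

theorem pderiv_compMat {k : Type*} [Field k] (F : MvPolynomial (Fin 3) k)
    (M : Matrix (Fin 3) (Fin 3) k) (j : Fin 3) :
    pderiv j (compMat F M) = ∑ l, compMat (pderiv l F) M * C (M l j) := by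
  unfold compMat
  induction F using MvPolynomial.induction_on with
  | C a => simp
  | add p q hp hq => simp only [map_add, hp, hq, add_mul, Finset.sum_add_distrib]
  | mul_X p i hp =>
    simp only [map_mul, Derivation.leibniz, hp, aeval_X, smul_eq_mul, map_add, add_mul,
      Finset.sum_add_distrib, map_sum, pderiv_X, pderiv_C]
    congr 1
    · fin_cases i <;> fin_cases j <;> simp [Fin.sum_univ_three, Pi.single_apply]
    · rw [Finset.mul_sum]
      exact Finset.sum_congr rfl fun l _ => by ring

theorem aeval_compMat {k : Type*} [Field k] (F : MvPolynomial (Fin 3) k)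
    (M : Matrix (Fin 3) (Fin 3) k) (v : Fin 3 → MvPolynomial (Fin 3) k) :
    aeval v (compMat F M) = aeval (fun i => ∑ j, C (M i j) * v j) F := by
  unfold compMat
  rw [← AlgHom.comp_apply, comp_aeval]
  simp [algebraMap_eq]

/-- Cofactor matrix, by cross products of the rows. -/
def cof {R : Type*} [CommRing R] (m : Fin 3 → Fin 3 → R) : Fin 3 → Fin 3 → R :=
  ![crs (m 1) (m 2), crs (m 2) (m 0), crs (m 0) (m 1)]

/-- the Caylean depends contravariantly of weight 4 on a ternary cubic form,
expressed as the polynomial identity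
`(xyz ∘ M⁻ᵀ) · D(F ∘ M) = (det M)⁴ · xyz · (D(F) ∘ M⁻ᵀ)`. -/
theorem caylean_contravariant {k : Type*} [Field k] (h2 : (2 : k) ≠ 0) (h3 : (3 : k) ≠ 0)
    (F : MvPolynomial (Fin 3) k) (hF : F.IsHomogeneous 3)
    (M : Matrix (Fin 3) (Fin 3) k) (hM : IsUnit M.det) :
    compMat (X 0 * X 1 * X 2) (M⁻¹)ᵀ * cayleanDet (compMat F M) =
      C (M.det ^ 4) * (X 0 * X 1 * X 2) * compMat (cayleanDet F) (M⁻¹)ᵀ := by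
  set N : Matrix (Fin 3) (Fin 3) k := (M⁻¹)ᵀ with hN
  have hd : M.det ≠ 0 := hM.ne_zero
  have hcof : ∀ i j, M.det * N i j = cof M i j := by
    intro i j
    have : M.det • M⁻¹ = M.adjugate := by
      rw [Matrix.inv_def, smul_smul, Ring.mul_inverse_cancel _ hM, one_smul]
    have h' := congrFun (congrFun this j) i
    rw [Matrix.smul_apply, smul_eq_mul] at h'
    rw [hN, Matrix.transpose_apply, h', Matrix.adjugate_fin_three]
    fin_cases i <;> fin_cases j <;> simp [cof, crs] <;> ring
  let G : Fin 3 → MvPolynomial (Fin 3) k := fun j => pderiv j F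
  have hG : ∀ j, (G j).IsHomogeneous 2 := fun j => hF.pderiv
  let U : Fin 3 → Fin 3 → MvPolynomial (Fin 3) k :=
    ![![0, X 2, -X 1], ![-X 2, 0, X 0], ![X 1, -X 0, 0]]
  let m : Fin 3 → Fin 3 → MvPolynomial (Fin 3) k := fun i j => C (M i j)
  let d : MvPolynomial (Fin 3) k := C M.det
  have hd0 : d ≠ 0 := by simpa [d] using hd
  have hdm : d = m 0 0 * (m 1 1 * m 2 2 - m 1 2 * m 2 1) + m 0 1 * (m 1 2 * m 2 0 - m 1 0 * m 2 2)
      + m 0 2 * (m 1 0 * m 2 1 - m 1 1 * m 2 0) := by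
    simp only [d, m, Matrix.det_fin_three, map_add, map_sub, map_mul]
    ring
  let w : Fin 3 → MvPolynomial (Fin 3) k := fun i => ∑ j, C (N i j) * X j
  let w' : Fin 3 → MvPolynomial (Fin 3) k := fun i => ∑ j, cof m i j * X j
  have hcm : ∀ i j, cof m i j = C (cof M i j) := by
    intro i j
    fin_cases i <;> fin_cases j <;> simp [cof, crs, m]
  have hww : ∀ i, w' i = d * w i := by
    intro i
    simp only [w', w, d, Finset.mul_sum, hcm, ← hcof, map_mul, mul_assoc]
  have hw0 : w' 0 ≠ 0 := by
    intro h
    have hz : ∀ j, cof M 0 j = 0 := by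
      intro j
      have := congrArg (pderiv j) h
      simp only [w', hcm, Fin.sum_univ_three, map_add, Derivation.leibniz, pderiv_C, pderiv_X] at this
      fin_cases j <;> simpa [Pi.single_apply] using this
    apply hd
    have h0 := hz 0
    have h1 := hz 1
    have h2 := hz 2
    simp [cof, crs] at h0 h1 h2
    rw [Matrix.det_fin_three]
    linear_combination M 0 0 * h0 + M 0 1 * h1 + M 0 2 * h2
  have main := crs_identity G hG w' hw0 (fun i l => cof m l i)
  -- the left-hand determinant
  let A : Matrix (Fin 3) (Fin 3) (MvPolynomial (Fin 3) k) :=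
    Matrix.of fun i l => aeval (fun a => ∑ j, m a j * U i j) (G l)
  have hA : cayleanDet (compMat F M) = A.det * d := by
    have : d = (M.map C).det := by
      simp only [d]
      rw [RingHom.map_det]; rfl
    rw [this, ← Matrix.det_mul]
    unfold cayleanDet
    congr 1
    ext1 i j
    simp only [Matrix.of_apply, pderiv_compMat, map_sum, map_mul, aeval_compMat, Matrix.mul_apply,
      Matrix.map_apply, A, aeval_C, algebraMap_eq]
    rfl
  have hcrs : ∀ i, crs w' (fun l => cof m l i) = fun a => d * ∑ j, m a j * U i j := by
    intro i
    rw [hdm]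
    funext a
    fin_cases i <;> fin_cases a <;>
      simp [crs, w', cof, U, Fin.sum_univ_three] <;> ring
  have hL : (Matrix.of fun i j : Fin 3 => aeval (crs w' (fun l => cof m l i)) (G j)).det
      = d ^ 6 * A.det := by
    have : (Matrix.of fun i j : Fin 3 => aeval (crs w' (fun l => cof m l i)) (G j))
        = d ^ 2 • A := by
      ext1 i j
      simp only [Matrix.of_apply, Matrix.smul_apply, smul_eq_mul, A]
      rw [hcrs, quad_scale _ (hG j)]
    rw [this, Matrix.det_smul, Fintype.card_fin]
    ring
  have hR : (Matrix.of fun i j : Fin 3 => aeval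
        (![![0, w' 2, -w' 1], ![-w' 2, 0, w' 0], ![w' 1, -w' 0, 0]] i) (G j)).det
      = d ^ 6 * compMat (cayleanDet F) N := by
    have : (Matrix.of fun i j : Fin 3 => aeval
        (![![0, w' 2, -w' 1], ![-w' 2, 0, w' 0], ![w' 1, -w' 0, 0]] i) (G j)) = d ^ 2 •
        (aeval w : MvPolynomial (Fin 3) k →ₐ[k] MvPolynomial (Fin 3) k).mapMatrix
          (Matrix.of fun i j : Fin 3 => aeval (U i) (pderiv j F)) := by
      ext1 i j
      have e : ![![0, w' 2, -w' 1], ![-w' 2, 0, w' 0], ![w' 1, -w' 0, 0]] i =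
          fun a => d * aeval w (U i a) := by
        funext a
        fin_cases i <;> fin_cases a <;> simp [U, hww]
      simp only [Matrix.of_apply, Matrix.smul_apply, smul_eq_mul, AlgHom.mapMatrix_apply,
        Matrix.map_apply]
      rw [e, quad_scale _ (hG j), ← AlgHom.comp_apply, comp_aeval]
    rw [this, Matrix.det_smul, Fintype.card_fin, ← AlgHom.map_det]
    unfold compMat cayleanDet
    ring
  have t0 : trp w' (fun l => cof m l 1) (fun l => cof m l 2) = d ^ 2 * X 0 := by
    rw [hdm]
    simp [trp, w', cof, crs, Fin.sum_univ_three]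
    ring
  have t1 : trp w' (fun l => cof m l 2) (fun l => cof m l 0) = d ^ 2 * X 1 := by
    rw [hdm]
    simp [trp, w', cof, crs, Fin.sum_univ_three]
    ring
  have t2 : trp w' (fun l => cof m l 0) (fun l => cof m l 1) = d ^ 2 * X 2 := by
    rw [hdm]
    simp [trp, w', cof, crs, Fin.sum_univ_three]
    ring
  have hx : compMat (X 0 * X 1 * X 2) N = w 0 * w 1 * w 2 := by
    simp only [compMat, map_mul, aeval_X, w]
  rw [hL, hR, t0, t1, t2, hww, hww, hww] at main
  rw [hA, hx, map_pow]
  apply mul_left_cancel₀ (pow_ne_zero 8 hd0)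
  change d ^ 8 * (w 0 * w 1 * w 2 * (A.det * d)) =
    d ^ 8 * (d ^ 4 * (X 0 * X 1 * X 2) * compMat (cayleanDet F) N)
  linear_combination main

end
end

section
/- Let k be an algebraically closed field of characteristic different from 2 and 3. For [s:t] ∈ ℙ¹(k), the ternary cubic form s(x³ + y³ + z³) + t·xyz has a singular point (i.e. a nonzero point (x,y,z) ∈ k³ at which all three partial derivatives of the form vanish) if and only if s = 0 or t³ = −27s³. Consequently the pencil of cubics s(x³+y³+z³) + t·xyz has exactly 4 singular members, namely those with [s:t] ∈ {[0:1], [1:−3], [1:−3ζ], [1:−3ζ²]}, where ζ is a primitive cube root of unity in k. -/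
open MvPolynomial
open scoped LinearAlgebra.Projectivization

noncomputable section

/-- The member `s(x³ + y³ + z³) + t·xyz` of the Hesse pencil. -/
def hessePencil {k : Type*} [Field k] (s t : k) : MvPolynomial (Fin 3) k :=
  C s * (X 0 ^ 3 + X 1 ^ 3 + X 2 ^ 3) + C t * (X 0 * X 1 * X 2)

/-- A homogeneous cubic form is singular if some nonzero point of `k³` kills all three
partial derivatives. -/
def IsSingularForm {k : Type*} [Field k] (G : MvPolynomial (Fin 3) k) : Prop :=
  ∃ v : Fin 3 → k, v ≠ 0 ∧ ∀ i : Fin 3, eval v (pderiv i G) = 0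

theorem isSingularForm_hessePencil_iff {k : Type*} [Field k] (s t : k) :
    IsSingularForm (hessePencil s t) ↔ ∃ x y z : k, ¬(x = 0 ∧ y = 0 ∧ z = 0) ∧
      3 * s * x ^ 2 + t * (y * z) = 0 ∧ 3 * s * y ^ 2 + t * (x * z) = 0 ∧
      3 * s * z ^ 2 + t * (x * y) = 0 := by
  have key : ∀ v : Fin 3 → k, (∀ i : Fin 3, eval v (pderiv i (hessePencil s t)) = 0) ↔
      (3 * s * v 0 ^ 2 + t * (v 1 * v 2) = 0 ∧ 3 * s * v 1 ^ 2 + t * (v 0 * v 2) = 0 ∧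
      3 * s * v 2 ^ 2 + t * (v 0 * v 1) = 0) := by
    intro v
    have e0 : eval v (pderiv 0 (hessePencil s t)) = 3 * s * v 0 ^ 2 + t * (v 1 * v 2) := by
      simp [hessePencil, pderiv_X, Pi.single_apply, Derivation.leibniz, Derivation.leibniz_pow]
      ring
    have e1 : eval v (pderiv 1 (hessePencil s t)) = 3 * s * v 1 ^ 2 + t * (v 0 * v 2) := by
      simp [hessePencil, pderiv_X, Pi.single_apply, Derivation.leibniz, Derivation.leibniz_pow]
      ring
    have e2 : eval v (pderiv 2 (hessePencil s t)) = 3 * s * v 2 ^ 2 + t * (v 0 * v 1) := by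
      simp [hessePencil, pderiv_X, Pi.single_apply, Derivation.leibniz, Derivation.leibniz_pow]
      ring
    rw [Fin.forall_fin_succ, Fin.forall_fin_succ, Fin.forall_fin_succ]
    rw [← e0, ← e1, ← e2]
    simp
  constructor
  · rintro ⟨v, hv, h⟩
    refine ⟨v 0, v 1, v 2, ?_, (key v).1 h⟩
    rintro ⟨a, b, c⟩
    apply hv
    ext i
    fin_cases i <;> simp [a, b, c]
  · rintro ⟨x, y, z, hn, h⟩
    refine ⟨![x, y, z], ?_, (key _).2 (by simpa using h)⟩
    intro hv
    apply hn
    exact ⟨by simpa using congrFun hv 0, by simpa using congrFun hv 1,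
      by simpa using congrFun hv 2⟩

theorem hessePencil_singular_iff {k : Type*} [Field k] (h3 : (3 : k) ≠ 0) (s t : k) :
    IsSingularForm (hessePencil s t) ↔ (s = 0 ∨ t ^ 3 = -27 * s ^ 3) := by
  rw [isSingularForm_hessePencil_iff]
  constructor
  · rintro ⟨x, y, z, hn, e1, e2, e3⟩
    by_cases hs : s = 0
    · exact Or.inl hs
    right
    have hs3 : 3 * s ≠ 0 := mul_ne_zero h3 hs
    have sq : ∀ a b : k, b = 0 → 3 * s * a ^ 2 + t * b = 0 → a = 0 := by
      intro a b hb h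
      rw [hb, mul_zero, add_zero] at h
      exact pow_eq_zero_iff (two_ne_zero) |>.1 ((mul_eq_zero.1 h).resolve_left hs3)
    have hx : x ≠ 0 := fun h => hn ⟨h, sq _ _ (by simp [h]) e2, sq _ _ (by simp [h]) e3⟩
    have hy : y ≠ 0 := fun h => hn ⟨sq _ _ (by simp [h]) e1, h, sq _ _ (by simp [h]) e3⟩
    have hz : z ≠ 0 := fun h => hn ⟨sq _ _ (by simp [h]) e1, sq _ _ (by simp [h]) e2, h⟩
    have hm : (x * y * z) ^ 2 ≠ 0 := pow_ne_zero _ (mul_ne_zero (mul_ne_zero hx hy) hz)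
    apply mul_right_cancel₀ hm
    have f1 : t * (y * z) = -(3 * s * x ^ 2) := by linear_combination e1
    have f2 : t * (x * z) = -(3 * s * y ^ 2) := by linear_combination e2
    have f3 : t * (x * y) = -(3 * s * z ^ 2) := by linear_combination e3
    calc t ^ 3 * (x * y * z) ^ 2 = (t * (y * z)) * (t * (x * z)) * (t * (x * y)) := by ring
      _ = _ := by rw [f1, f2, f3]; ring
  · intro h
    by_cases hs : s = 0
    · exact ⟨1, 0, 0, by simp, by simp [hs], by simp, by simp⟩
    have h := h.resolve_left hs
    have h9 : 9 * s ^ 2 ≠ 0 := by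
      have := pow_ne_zero 2 (mul_ne_zero h3 hs)
      intro h; apply this; linear_combination h
    refine ⟨t ^ 2, 9 * s ^ 2, 9 * s ^ 2, fun h => h9 h.2.1, ?_, ?_, ?_⟩
    · linear_combination 3 * s * t * h
    · linear_combination 9 * s ^ 2 * h
    · linear_combination 9 * s ^ 2 * h

theorem mk_eq_mk_pair_iff {k : Type*} [Field k] (v w : Fin 2 → k) (hv : v ≠ 0) (hw : w ≠ 0) :
    Projectivization.mk k v hv = Projectivization.mk k w hw ↔ v 0 * w 1 = v 1 * w 0 := by
  rw [Projectivization.mk_eq_mk_iff']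
  constructor
  · rintro ⟨a, rfl⟩
    simp only [Pi.smul_apply, smul_eq_mul]
    ring
  · intro h
    by_cases h0 : w 0 = 0
    · have h1 : w 1 ≠ 0 := by
        intro h1; apply hw; ext i; fin_cases i <;> simp [h0, h1]
      have hv0 : v 0 = 0 := by
        rw [h0, mul_zero] at h
        exact (mul_eq_zero.1 h).resolve_right h1
      refine ⟨v 1 / w 1, ?_⟩
      ext i
      fin_cases i
      · simp [h0, hv0]
      · simp [h1]
    · refine ⟨v 0 / w 0, ?_⟩
      ext i
      fin_cases i
      · simp [h0]
      · simp only [Pi.smul_apply, smul_eq_mul, Fin.mk_one]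
        field_simp
        linear_combination h

/-- over an algebraically closed field of characteristic ≠ 2, 3, the member
`s(x³+y³+z³) + t·xyz` of the Hesse pencil is singular iff `s = 0` or `t³ = -27s³`;
consequently the pencil has exactly the 4 singular members
`[s:t] ∈ {[0:1], [1:-3], [1:-3ζ], [1:-3ζ²]}` where `ζ` is a primitive cube root of unity. -/
theorem hessePencil_singular_members (k : Type*) [Field k] [IsAlgClosed k]
    (h2 : (2 : k) ≠ 0) (h3 : (3 : k) ≠ 0) (ζ : k) (hζ3 : ζ ^ 3 = 1) (hζ1 : ζ ≠ 1) :
    (∀ s t : k, ¬(s = 0 ∧ t = 0) →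
      (IsSingularForm (hessePencil s t) ↔ (s = 0 ∨ t ^ 3 = -27 * s ^ 3))) ∧
    {p : ℙ k (Fin 2 → k) | IsSingularForm (hessePencil (p.rep 0) (p.rep 1))} =
      {Projectivization.mk k ![0, 1] (fun h => one_ne_zero (congrFun h 1)),
       Projectivization.mk k ![1, -3] (fun h => one_ne_zero (congrFun h 0)),
       Projectivization.mk k ![1, -3 * ζ] (fun h => one_ne_zero (congrFun h 0)),
       Projectivization.mk k ![1, -3 * ζ ^ 2] (fun h => one_ne_zero (congrFun h 0))} ∧
    {p : ℙ k (Fin 2 → k) | IsSingularForm (hessePencil (p.rep 0) (p.rep 1))}.ncard = 4 := by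
  have hz : 1 + ζ + ζ ^ 2 = 0 := by
    have h : (ζ - 1) * (1 + ζ + ζ ^ 2) = 0 := by linear_combination hζ3
    exact (mul_eq_zero.1 h).resolve_left (sub_ne_zero.2 hζ1)
  have hz0 : ζ ≠ 0 := by
    rintro rfl
    simp at hζ3
  have hset : {p : ℙ k (Fin 2 → k) | IsSingularForm (hessePencil (p.rep 0) (p.rep 1))} =
      {Projectivization.mk k ![0, 1] (fun h => one_ne_zero (congrFun h 1)),
       Projectivization.mk k ![1, -3] (fun h => one_ne_zero (congrFun h 0)),
       Projectivization.mk k ![1, -3 * ζ] (fun h => one_ne_zero (congrFun h 0)),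
       Projectivization.mk k ![1, -3 * ζ ^ 2] (fun h => one_ne_zero (congrFun h 0))} := by
    ext p
    have hp : ∀ (w : Fin 2 → k) (hw : w ≠ 0), p = Projectivization.mk k w hw ↔
        p.rep 0 * w 1 = p.rep 1 * w 0 := by
      intro w hw
      rw [← mk_eq_mk_pair_iff p.rep w p.rep_nonzero hw, Projectivization.mk_rep]
    simp only [Set.mem_setOf_eq, Set.mem_insert_iff, Set.mem_singleton_iff, hp,
      hessePencil_singular_iff h3]
    generalize p.rep 0 = s
    generalize p.rep 1 = t
    simp only [Matrix.cons_val_zero, Matrix.cons_val_one, mul_one, mul_zero]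
    refine or_congr Iff.rfl ?_
    have hf : t ^ 3 + 27 * s ^ 3 = (s * -3 - t) * ((s * (-3 * ζ) - t) * (s * (-3 * ζ ^ 2) - t)) * (-1) := by
      linear_combination (-27 * s ^ 3) * hζ3 - (3 * s * t ^ 2 + 9 * s ^ 2 * t * ζ) * hz
    rw [← sub_eq_zero (b := t), ← sub_eq_zero (b := t), ← sub_eq_zero (b := t),
      ← mul_eq_zero, ← mul_eq_zero]
    constructor
    · intro h
      linear_combination -h + hf
    · intro h
      linear_combination hf - h
  refine ⟨fun s t _ => hessePencil_singular_iff h3 s t, hset, ?_⟩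
  have h12 : ζ ^ 2 ≠ 1 := by
    intro h
    apply hζ1
    linear_combination hζ3 - ζ * h
  have h23 : ζ ^ 2 ≠ ζ := by
    intro h
    apply hζ1
    apply mul_left_cancel₀ hz0
    linear_combination h
  have c3 : ∀ a b : k, a ≠ b → -3 * a ≠ -3 * b := fun a b hab h =>
    hab (mul_left_cancel₀ (neg_ne_zero.2 h3) h)
  have d1 := c3 _ _ hζ1
  have d2 := c3 _ _ h12
  have d3 := c3 _ _ h23
  rw [mul_one] at d1 d2
  rw [hset, Set.ncard_insert_of_notMem, Set.ncard_insert_of_notMem, Set.ncard_pair]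
  · rw [Ne, mk_eq_mk_pair_iff]
    simpa using d3
  · simp only [Set.mem_insert_iff, Set.mem_singleton_iff, mk_eq_mk_pair_iff]
    simp only [Matrix.cons_val_zero, Matrix.cons_val_one, mul_one, one_mul, not_or]
    exact ⟨d1, d2⟩
  · simp only [Set.mem_insert_iff, Set.mem_singleton_iff, mk_eq_mk_pair_iff]
    simp

end
end

section
/- Let k be an algebraically closed field of characteristic different from 2 and 3 and let F ∈ k[x,y,z] be a ternary cubic form defining a smooth plane cubic curve, i.e. such that there is no nonzero (x,y,z) ∈ k³ at which all three partial derivatives of F vanish. Then F and its Hessian H(F) are linearly independent over k. -/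
open MvPolynomial

noncomputable section

/-- The Hessian of a ternary cubic form: `H(F) = -(1/2) · det(∂²F/∂xᵢ∂xⱼ)`. -/
def hessian {k : Type*} [Field k] (F : MvPolynomial (Fin 3) k) : MvPolynomial (Fin 3) k :=
  - C (2 : k)⁻¹ * (Matrix.of fun i j : Fin 3 => pderiv i (pderiv j F)).det

/-- Core linear-algebra argument: `M v` is the (linear in `v`) Hessian matrix of a cubic. -/
theorem hess_core {k : Type*} [Field k] [IsAlgClosed k]
    (M : (Fin 3 → k) →ₗ[k] Matrix (Fin 3) (Fin 3) k) (c : k)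
    (hcomm : ∀ u v, (M u).mulVec v = (M v).mulVec u)
    (hsymm : ∀ u v w, (M u).mulVec v ⬝ᵥ w = (M u).mulVec w ⬝ᵥ v)
    (hdet : ∀ u, (M u).det = c * ((M u).mulVec u ⬝ᵥ u))
    (p : Fin 3 → k) (hp : p ≠ 0) (hFp : (M p).mulVec p ⬝ᵥ p = 0) :
    ∃ v, v ≠ 0 ∧ (M v).mulVec v = 0 := by
  by_contra hcon
  push Not at hcon
  have hl := hcon p hp
  obtain ⟨q, hq, hpq⟩ := Matrix.exists_mulVec_eq_zero_iff.2
    (show (M p).det = 0 by rw [hdet, hFp, mul_zero])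
  have hqp : (M q).mulVec p = 0 := by rw [hcomm, hpq]
  -- the span of `p, q` is the kernel of `T(p,p,-)`
  have hspan : ∀ w, (M p).mulVec p ⬝ᵥ w = 0 → ∃ a b : k, w = a • p + b • q := by
    intro w hw
    have hd : (Matrix.of ![p, q, w]).det = 0 := by
      apply Matrix.exists_mulVec_eq_zero_iff.1
      refine ⟨(M p).mulVec p, hl, ?_⟩
      have h1 : (M p).mulVec p ⬝ᵥ q = 0 := by rw [hsymm, hpq, zero_dotProduct]
      ext i
      fin_cases i
      · simpa [Matrix.mulVec, dotProduct_comm] using hFp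
      · simpa [Matrix.mulVec, dotProduct_comm] using h1
      · simpa [Matrix.mulVec, dotProduct_comm] using hw
    obtain ⟨s, hs, hs0⟩ := Matrix.exists_vecMul_eq_zero_iff.2 hd
    have hlin : s 0 • p + s 1 • q + s 2 • w = 0 := by
      rw [← hs0]
      ext i
      simp [Matrix.vecMul, dotProduct, Fin.sum_univ_three]
    have h2 : s 2 ≠ 0 := by
      intro h2
      rw [h2, zero_smul, add_zero] at hlin
      have h3 := congrArg (fun x => (M p).mulVec x) hlin
      simp only [Matrix.mulVec_add, Matrix.mulVec_smul, hpq, smul_zero, add_zero,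
        Matrix.mulVec_zero] at h3
      have h0 : s 0 = 0 := (smul_eq_zero.1 h3).resolve_right hl
      rw [h0, zero_smul, zero_add] at hlin
      have h1 : s 1 = 0 := (smul_eq_zero.1 hlin).resolve_right hq
      apply hs
      ext i
      fin_cases i <;> simp [h0, h1, h2]
    refine ⟨-(s 0 / s 2), -(s 1 / s 2), ?_⟩
    have h4 : w = (s 2)⁻¹ • (s 2 • w) := by rw [smul_smul, inv_mul_cancel₀ h2, one_smul]
    have h5 : s 2 • w = -(s 0 • p + s 1 • q) := by
      rw [eq_neg_iff_add_eq_zero, ← hlin]; abel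
    rw [h4, h5]
    ext i
    simp
    field_simp
    ring
  -- T(q,q,q) = 0
  have hce : c * ((M q).mulVec q ⬝ᵥ q) = 0 := by
    rw [← hdet]
    exact Matrix.exists_mulVec_eq_zero_iff.1 ⟨p, hp, hqp⟩
  have hadd : ∀ w, (M (q + p)).mulVec w = (M q).mulVec w + (M p).mulVec w := by
    intro w; rw [map_add, Matrix.add_mulVec]
  have he : (M q).mulVec q ⬝ᵥ q = 0 := by
    have hd : (M (q + p)).det = 0 := by
      have h6 : (M p).mulVec p ⬝ᵥ q = 0 := by rw [hsymm, hpq, zero_dotProduct]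
      have h7 : (M q).mulVec q ⬝ᵥ p = 0 := by rw [hsymm, hqp, zero_dotProduct]
      rw [hdet, hadd, Matrix.mulVec_add, Matrix.mulVec_add, hpq, hqp]
      simp only [add_zero, zero_add, add_dotProduct, dotProduct_add, hFp, h6, h7]
      exact hce
    obtain ⟨w, hw, hw0⟩ := Matrix.exists_mulVec_eq_zero_iff.2 hd
    have hwl : (M p).mulVec p ⬝ᵥ w = 0 := by
      have : (M (q + p)).mulVec w ⬝ᵥ p = 0 := by rw [hw0, zero_dotProduct]
      rw [hsymm, hadd, hqp, zero_add] at this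
      exact this
    obtain ⟨a, b, rfl⟩ := hspan w hwl
    rw [hadd] at hw0
    simp only [Matrix.mulVec_add, Matrix.mulVec_smul, hpq, hqp, smul_zero, add_zero,
      zero_add] at hw0
    have h8 := congrArg (fun x => x ⬝ᵥ q) hw0
    have h6 : (M p).mulVec p ⬝ᵥ q = 0 := by rw [hsymm, hpq, zero_dotProduct]
    simp only [add_dotProduct, smul_dotProduct, h6, smul_zero, zero_dotProduct, add_zero] at h8
    rcases smul_eq_zero.1 h8 with hb | hb
    · exfalso
      rw [hb, zero_smul, zero_add] at hw0
      have ha : a = 0 := (smul_eq_zero.1 hw0).resolve_right hl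
      apply hw
      simp [ha, hb]
    · exact hb
  -- `M q q` is a multiple of `M p p`
  obtain ⟨r, hr⟩ : ∃ r, (M p).mulVec p ⬝ᵥ r ≠ 0 := by
    by_contra hno
    push Not at hno
    exact hl (dotProduct_eq_zero _ hno)
  set d := (M p).mulVec p ⬝ᵥ r with hd
  set f := (M q).mulVec q ⬝ᵥ r with hf
  have hmul : (M q).mulVec q = (f / d) • (M p).mulVec p := by
    rw [← sub_eq_zero]
    apply dotProduct_eq_zero
    intro x
    obtain ⟨a, b, hab⟩ := hspan (x - (((M p).mulVec p ⬝ᵥ x) / d) • r) (by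
      rw [dotProduct_sub, dotProduct_smul, ← hd, smul_eq_mul, div_mul_cancel₀ _ hr, sub_self])
    have hx : x = a • p + b • q + (((M p).mulVec p ⬝ᵥ x) / d) • r := by
      rw [← hab]; abel
    have h6 : (M p).mulVec p ⬝ᵥ q = 0 := by rw [hsymm, hpq, zero_dotProduct]
    have h7 : (M q).mulVec q ⬝ᵥ p = 0 := by rw [hsymm, hqp, zero_dotProduct]
    rw [hx]
    simp only [sub_dotProduct, dotProduct_add, dotProduct_smul, smul_dotProduct, h6, h7, he, hFp,
      ← hd, ← hf, smul_eq_mul]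
    field_simp
    ring
  obtain ⟨z, hz⟩ := IsAlgClosed.exists_pow_nat_eq (-(f / d)) (n := 2) (by norm_num)
  have hv : q + z • p ≠ 0 := by
    intro h0
    have h3 := congrArg (fun x => (M p).mulVec x) h0
    simp only [Matrix.mulVec_add, Matrix.mulVec_smul, hpq, zero_add, Matrix.mulVec_zero] at h3
    have hz0 : z = 0 := (smul_eq_zero.1 h3).resolve_right hl
    rw [hz0, zero_smul, add_zero] at h0
    exact hq h0
  apply hcon _ hv
  rw [map_add, map_smul, Matrix.add_mulVec, Matrix.smul_mulVec]
  simp only [Matrix.mulVec_add, Matrix.mulVec_smul, hpq, hqp, smul_zero, add_zero, zero_add]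
  rw [hmul, smul_smul, ← add_smul, ← pow_two, hz, add_neg_cancel, zero_smul]

/-- A cubic over an algebraically closed field has a nontrivial zero. -/
theorem exists_zero_form {k : Type*} [Field k] [IsAlgClosed k]
    (M : (Fin 3 → k) →ₗ[k] Matrix (Fin 3) (Fin 3) k)
    : ∃ p : Fin 3 → k, p ≠ 0 ∧ (M p).mulVec p ⬝ᵥ p = 0 := by
  let u : Fin 3 → k := ![1, 0, 0]
  let v : Fin 3 → k := ![0, 1, 0]
  by_cases h : (M u).mulVec u ⬝ᵥ u = 0
  · exact ⟨u, fun h0 => by simpa [u] using congrFun h0 0, h⟩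
  · obtain ⟨x, hx⟩ := IsAlgClosed.exists_root
      (Cubic.toPoly ⟨(M u).mulVec u ⬝ᵥ u,
        (M u).mulVec u ⬝ᵥ v + (M u).mulVec v ⬝ᵥ u + (M v).mulVec u ⬝ᵥ u,
        (M u).mulVec v ⬝ᵥ v + (M v).mulVec u ⬝ᵥ v + (M v).mulVec v ⬝ᵥ u,
        (M v).mulVec v ⬝ᵥ v⟩) (by rw [Cubic.degree_of_a_ne_zero (by exact h)]; norm_num)
    refine ⟨x • u + v, fun h0 => by simpa [u, v] using congrFun h0 1, ?_⟩
    simp only [Cubic.toPoly, Polynomial.IsRoot, Polynomial.eval_add, Polynomial.eval_mul,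
      Polynomial.eval_C, Polynomial.eval_pow, Polynomial.eval_X] at hx
    rw [← hx, map_add, map_smul, Matrix.add_mulVec, Matrix.smul_mulVec]
    simp only [Matrix.mulVec_add, Matrix.mulVec_smul, add_dotProduct, dotProduct_add,
      smul_dotProduct, dotProduct_smul, smul_eq_mul, smul_add]
    ring

/-- over an algebraically closed field of characteristic ≠ 2, 3, a ternary
cubic form `F` defining a smooth plane cubic is linearly independent from its Hessian. -/
theorem linearIndependent_self_hessian (k : Type*) [Field k] [IsAlgClosed k]
    (h2 : (2 : k) ≠ 0) (h3 : (3 : k) ≠ 0)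
    (F : MvPolynomial (Fin 3) k) (hF : F.IsHomogeneous 3)
    (hsmooth : ¬ ∃ v : Fin 3 → k, v ≠ 0 ∧ ∀ i : Fin 3, eval v (pderiv i F) = 0) :
    LinearIndependent k ![F, hessian F] := by
  have hd1 : ∀ i, (pderiv i F).IsHomogeneous 2 := fun i => hF.pderiv
  have hd2 : ∀ i j, (pderiv i (pderiv j F)).IsHomogeneous 1 := fun i j => (hd1 j).pderiv
  have hd3 : ∀ l i j, (pderiv l (pderiv i (pderiv j F))).IsHomogeneous 0 :=
    fun l i j => (hd2 i j).pderiv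
  have hpc : ∀ (i j : Fin 3) (G : MvPolynomial (Fin 3) k),
      pderiv i (pderiv j G) = pderiv j (pderiv i G) := by
    intro i j G
    have hbr : ⁅pderiv (R := k) i, pderiv (R := k) j⁆ = 0 := by
      apply derivation_ext
      intro l
      rw [Derivation.commutator_apply]
      by_cases h1 : i = l <;> by_cases h2 : j = l <;> simp [pderiv_X, h1, h2]
    have := congrArg (fun D => D G) hbr
    simp only [Derivation.commutator_apply, Derivation.zero_apply] at this
    exact sub_eq_zero.1 this
  let t : Fin 3 → Fin 3 → Fin 3 → k := fun l i j => eval 0 (pderiv l (pderiv i (pderiv j F)))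
  have ht : ∀ l i j v, eval v (pderiv l (pderiv i (pderiv j F))) = t l i j := by
    intro l i j v
    have := totalDegree_eq_zero_iff_eq_C.1 (Nat.le_zero.1 (hd3 l i j).totalDegree_le)
    simp only [t]
    rw [this]; simp
  have ht1 : ∀ l i j, t l i j = t i l j := fun l i j => by simp only [t]; rw [hpc]
  have ht2 : ∀ l i j, t l i j = t l j i := fun l i j => by simp only [t]; rw [hpc i j]
  have e2 : ∀ i j v, eval v (pderiv i (pderiv j F)) = ∑ l, t l i j * v l := by
    intro i j v
    have := congrArg (eval v) (hd2 i j).sum_X_mul_pderiv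
    simp only [map_sum, map_mul, eval_X, ht, one_smul] at this
    rw [← this]
    exact Finset.sum_congr rfl fun _ _ => mul_comm _ _
  have e1 : ∀ j v, 2 * eval v (pderiv j F) = ∑ i, v i * eval v (pderiv i (pderiv j F)) := by
    intro j v
    have := congrArg (eval v) (hd1 j).sum_X_mul_pderiv
    simp only [map_sum, map_mul, eval_X, nsmul_eq_mul] at this
    rw [this]; norm_num
  have e0 : ∀ v, 3 * eval v F = ∑ i, v i * eval v (pderiv i F) := by
    intro v
    have := congrArg (eval v) hF.sum_X_mul_pderiv
    simp only [map_sum, map_mul, eval_X, nsmul_eq_mul] at this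
    rw [this]; norm_num
  let M : (Fin 3 → k) →ₗ[k] Matrix (Fin 3) (Fin 3) k :=
    { toFun := fun v => Matrix.of fun i j => ∑ l, t l i j * v l
      map_add' := by
        intro u v; ext i j
        simp [mul_add, Finset.sum_add_distrib]
      map_smul' := by
        intro a v; ext i j
        simp [Finset.mul_sum, mul_left_comm] }
  have hM : ∀ v i j, M v i j = ∑ l, t l i j * v l := fun _ _ _ => rfl
  have hMt : ∀ v i j, M v i j = M v j i := by
    intro v i j
    rw [hM, hM]
    exact Finset.sum_congr rfl fun l _ => by rw [ht2]
  have g1 : ∀ v j, (M v).mulVec v j = 2 * eval v (pderiv j F) := by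
    intro v j
    rw [e1]
    simp only [Matrix.mulVec, dotProduct]
    exact Finset.sum_congr rfl fun i _ => by rw [hMt, hM, e2, mul_comm]
  have g0 : ∀ v, (M v).mulVec v ⬝ᵥ v = 6 * eval v F := by
    intro v
    have : (6 : k) * eval v F = 2 * (3 * eval v F) := by ring
    rw [this, e0, Finset.mul_sum]
    simp only [dotProduct, g1]
    exact Finset.sum_congr rfl fun i _ => by ring
  have h6 : (6 : k) ≠ 0 := by
    have : (6 : k) = 2 * 3 := by norm_num
    rw [this]; exact mul_ne_zero h2 h3
  have hH : ∀ v, eval v (hessian F) = -(2 : k)⁻¹ * (M v).det := by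
    intro v
    simp only [hessian, map_mul, map_neg, eval_C]
    rw [RingHom.map_det]
    congr 2
    ext i j
    simp [hM, e2]
  rw [LinearIndependent.pair_iff]
  intro a b hab
  by_cases hb : b = 0
  · refine ⟨?_, hb⟩
    rw [hb, zero_smul, add_zero] at hab
    rcases smul_eq_zero.1 hab with h | h
    · exact h
    · exfalso
      apply hsmooth
      exact ⟨fun _ => 1, fun h0 => one_ne_zero (congrFun h0 0), fun i => by simp [h]⟩
  · exfalso
    obtain ⟨p, hp, hFp⟩ := exists_zero_form M
    have hA : ∀ u v, (M u).mulVec v = (M v).mulVec u := by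
      intro u v
      ext i
      simp only [Matrix.mulVec, dotProduct, hM, Finset.sum_mul]
      rw [Finset.sum_comm]
      refine Finset.sum_congr rfl fun l _ => Finset.sum_congr rfl fun j _ => ?_
      rw [show t l i j = t j i l by rw [ht1, ht2, ht1]]
      ring
    have hB : ∀ u v w, (M u).mulVec v ⬝ᵥ w = (M u).mulVec w ⬝ᵥ v := by
      intro u v w
      simp only [Matrix.mulVec, dotProduct, Finset.sum_mul]
      rw [Finset.sum_comm]
      refine Finset.sum_congr rfl fun l _ => Finset.sum_congr rfl fun j _ => ?_
      rw [hMt]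
      ring
    have hC : ∀ u, (M u).det = (2 * a / b / 6) * ((M u).mulVec u ⬝ᵥ u) := by
      intro u
      have := congrArg (eval u) hab
      simp only [map_add, smul_eval, hH, map_zero] at this
      rw [g0]
      field_simp at this ⊢
      linear_combination -this
    obtain ⟨v, hv, hv0⟩ := hess_core M (2 * a / b / 6) hA hB hC p hp hFp
    apply hsmooth
    refine ⟨v, hv, fun i => ?_⟩
    have := congrFun hv0 i
    rw [g1] at this
    exact (mul_eq_zero.1 this).resolve_left h2

end
end

section
/- Let k be an algebraically closed field of characteristic different from 3 and let Φ₀ := {[x:y:z] ∈ ℙ²(k) : x³ + y³ + z³ = xyz = 0}. Then for any two distinct points P, Q ∈ Φ₀, the projective line through P and Q contains exactly one further point of Φ₀; that is, the line through P and Q meets Φ₀ in exactly 3 points. -/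
open scoped LinearAlgebra.Projectivization

noncomputable section

/-- The flex scheme `Φ₀ = {[x:y:z] ∈ ℙ²(k) : x³ + y³ + z³ = xyz = 0}`. -/
def flexScheme0 (k : Type*) [Field k] : Set (ℙ k (Fin 3 → k)) :=
  {P | P.rep 0 ^ 3 + P.rep 1 ^ 3 + P.rep 2 ^ 3 = 0 ∧ P.rep 0 * P.rep 1 * P.rep 2 = 0}

lemma flex_caseA {k : Type*} [Field k] (h3 : (3 : k) ≠ 0) {x y z w : k}
    (hp : x ^ 3 + y ^ 3 = 0) (hq : z ^ 3 + w ^ 3 = 0) (hd : x * w - y * z ≠ 0) :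
    ∃ c : k, c ≠ 0 ∧ ∀ a b : k, (a * x + b * z) ^ 3 + (a * y + b * w) ^ 3 = 0 ↔
      (a = 0 ∨ b = 0 ∨ b = c * a) := by
  have hy : y ≠ 0 := by
    rintro rfl
    have : x = 0 := by simpa using hp
    subst this
    simp at hd
  have hw : w ≠ 0 := by
    rintro rfl
    have : z = 0 := by simpa using hq
    subst this
    simp at hd
  have hA : x ^ 2 * z + y ^ 2 * w ≠ 0 := by
    intro h
    have : y ^ 2 * (x * w - y * z) = 0 := by linear_combination x * h - z * hp
    simp [hy, hd] at this
  have hB : x * z ^ 2 + y * w ^ 2 ≠ 0 := by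
    intro h
    have : w ^ 2 * (x * w - y * z) = 0 := by linear_combination x * hq - z * h
    simp [hw, hd] at this
  refine ⟨-(x ^ 2 * z + y ^ 2 * w) / (x * z ^ 2 + y * w ^ 2), div_ne_zero (neg_ne_zero.mpr hA) hB, ?_⟩
  intro a b
  have e : (a * x + b * z) ^ 3 + (a * y + b * w) ^ 3 =
      3 * (a * (b * (a * (x ^ 2 * z + y ^ 2 * w) + b * (x * z ^ 2 + y * w ^ 2)))) := by
    linear_combination a ^ 3 * hp + b ^ 3 * hq
  rw [e, mul_eq_zero, or_iff_right h3, mul_eq_zero, mul_eq_zero]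
  refine or_congr_right (or_congr_right ?_)
  rw [div_mul_eq_mul_div, eq_div_iff hB]
  constructor <;> intro h <;> linear_combination h

lemma flex_caseB {k : Type*} [Field k] {y z u w : k}
    (hp : y ^ 3 + z ^ 3 = 0) (hq : u ^ 3 + w ^ 3 = 0) (hy : y ≠ 0) (hu : u ≠ 0) :
    ∃ c : k, c ≠ 0 ∧ ∀ a b : k, ((b * u) ^ 3 + (a * y) ^ 3 + (a * z + b * w) ^ 3 = 0 ∧
      (b * u) * (a * y) * (a * z + b * w) = 0) ↔
      (a = 0 ∨ b = 0 ∨ b = c * a) := by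
  have hz : z ≠ 0 := by
    rintro rfl
    simp [hy] at hp
  have hw : w ≠ 0 := by
    rintro rfl
    simp [hu] at hq
  refine ⟨-z / w, by simp [hz, hw], ?_⟩
  intro a b
  have e : (b * u) ^ 3 + (a * y) ^ 3 + (a * z + b * w) ^ 3 =
      3 * a * b * z * w * (a * z + b * w) := by
    linear_combination a ^ 3 * hp + b ^ 3 * hq
  rw [e, div_mul_eq_mul_div, eq_div_iff hw]
  have e2 : b * w = -z * a ↔ a * z + b * w = 0 := by
    constructor <;> intro h <;> linear_combination h
  rw [e2]
  constructor
  · rintro ⟨-, h⟩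
    simp only [mul_eq_zero, hu, hy, or_false] at h
    tauto
  · rintro (h | h | h) <;> simp [h]

lemma flex_line {k : Type*} [Field k] (h3 : (3 : k) ≠ 0) (p q : Fin 3 → k)
    (hp : p 0 ^ 3 + p 1 ^ 3 + p 2 ^ 3 = 0 ∧ p 0 * p 1 * p 2 = 0)
    (hq : q 0 ^ 3 + q 1 ^ 3 + q 2 ^ 3 = 0 ∧ q 0 * q 1 * q 2 = 0)
    (hpq : ∀ a b : k, a • p + b • q = 0 → a = 0 ∧ b = 0) :
    ∃ c : k, c ≠ 0 ∧ ∀ a b : k,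
      (((a • p + b • q) 0 ^ 3 + (a • p + b • q) 1 ^ 3 + (a • p + b • q) 2 ^ 3 = 0 ∧
        (a • p + b • q) 0 * (a • p + b • q) 1 * (a • p + b • q) 2 = 0) ↔
      (a = 0 ∨ b = 0 ∨ b = c * a)) := by
  have hne : ∀ i j l : Fin 3, (∀ m, m = i ∨ m = j ∨ m = l) → p i = 0 → q i = 0 →
      p j * q l - p l * q j ≠ 0 := by
    intro i j l hm hi hi' h
    have h1 := hpq (q l) (-p l) (by
      funext m
      change q l * p m + -p l * q m = 0
      rcases hm m with e | e | e <;> rw [e]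
      · linear_combination q l * hi - p l * hi'
      · linear_combination h
      · ring)
    have h2 := hpq (q j) (-p j) (by
      funext m
      change q j * p m + -p j * q m = 0
      rcases hm m with e | e | e <;> rw [e]
      · linear_combination q j * hi - p j * hi'
      · ring
      · linear_combination -h)
    have h4 := hpq 1 0 (by
      funext m
      change 1 * p m + 0 * q m = 0
      rcases hm m with e | e | e <;> rw [e]
      · linear_combination hi
      · linear_combination -h2.2
      · linear_combination -h1.2)
    exact one_ne_zero h4.1
  have hp0 : ¬ (p 0 = 0 ∧ p 1 = 0 ∧ p 2 = 0) := by
    rintro ⟨h0, h1, h2⟩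
    have h4 := hpq 1 0 (by
      funext m
      fin_cases m <;> simp [h0, h1, h2])
    simp at h4
  have hq0 : ¬ (q 0 = 0 ∧ q 1 = 0 ∧ q 2 = 0) := by
    rintro ⟨h0, h1, h2⟩
    have h4 := hpq 0 1 (by
      funext m
      fin_cases m <;> simp [h0, h1, h2])
    simp at h4
  have d0 := hne 0 1 2 (by decide)
  have d1 := hne 1 0 2 (by decide)
  have d2 := hne 2 0 1 (by decide)
  clear hne hpq
  simp only [Pi.add_apply, Pi.smul_apply, smul_eq_mul]
  obtain ⟨hp1, hp2⟩ := hp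
  obtain ⟨hq1, hq2⟩ := hq
  generalize p 0 = p0 at *
  generalize p 1 = p1 at *
  generalize p 2 = p2 at *
  generalize q 0 = q0 at *
  generalize q 1 = q1 at *
  generalize q 2 = q2 at *
  have nz : ∀ s t : k, s ^ 3 + t ^ 3 = 0 → ¬ (s = 0 ∧ t = 0) → s ≠ 0 ∧ t ≠ 0 := by
    intro s t h hn
    constructor
    · rintro rfl
      exact hn ⟨rfl, by simpa using h⟩
    · rintro rfl
      exact hn ⟨by simpa using h, rfl⟩
  simp only [mul_eq_zero] at hp2 hq2
  rcases hp2 with (rfl | rfl) | rfl <;> rcases hq2 with (rfl | rfl) | rfl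
  · obtain ⟨c, hc, h⟩ := flex_caseA h3 (x := p1) (y := p2) (z := q1) (w := q2)
      (by linear_combination hp1) (by linear_combination hq1) (d0 rfl rfl)
    exact ⟨c, hc, fun a b => by rw [← h a b]; simp⟩
  · obtain ⟨c, hc, h⟩ := flex_caseB (y := p1) (z := p2) (u := q0) (w := q2)
      (by linear_combination hp1) (by linear_combination hq1) (by grind) (by grind)
    exact ⟨c, hc, fun a b => by rw [← h a b]; ring_nf⟩
  · obtain ⟨c, hc, h⟩ := flex_caseB (y := p2) (z := p1) (u := q0) (w := q1)
      (by linear_combination hp1) (by linear_combination hq1) (by grind) (by grind)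
    exact ⟨c, hc, fun a b => by rw [← h a b]; ring_nf⟩
  · obtain ⟨c, hc, h⟩ := flex_caseB (y := p0) (z := p2) (u := q1) (w := q2)
      (by linear_combination hp1) (by linear_combination hq1) (by grind) (by grind)
    exact ⟨c, hc, fun a b => by rw [← h a b]; ring_nf⟩
  · obtain ⟨c, hc, h⟩ := flex_caseA h3 (x := p0) (y := p2) (z := q0) (w := q2)
      (by linear_combination hp1) (by linear_combination hq1) (d1 rfl rfl)
    exact ⟨c, hc, fun a b => by rw [← h a b]; simp⟩
  · obtain ⟨c, hc, h⟩ := flex_caseB (y := p2) (z := p0) (u := q1) (w := q0)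
      (by linear_combination hp1) (by linear_combination hq1) (by grind) (by grind)
    exact ⟨c, hc, fun a b => by rw [← h a b]; ring_nf⟩
  · obtain ⟨c, hc, h⟩ := flex_caseB (y := p0) (z := p1) (u := q2) (w := q1)
      (by linear_combination hp1) (by linear_combination hq1) (by grind) (by grind)
    exact ⟨c, hc, fun a b => by rw [← h a b]; ring_nf⟩
  · obtain ⟨c, hc, h⟩ := flex_caseB (y := p1) (z := p0) (u := q2) (w := q0)
      (by linear_combination hp1) (by linear_combination hq1) (by grind) (by grind)
    exact ⟨c, hc, fun a b => by rw [← h a b]; ring_nf⟩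
  · obtain ⟨c, hc, h⟩ := flex_caseA h3 (x := p0) (y := p1) (z := q0) (w := q1)
      (by linear_combination hp1) (by linear_combination hq1) (d2 rfl rfl)
    exact ⟨c, hc, fun a b => by rw [← h a b]; simp⟩

/-- over an algebraically closed field of characteristic ≠ 3, the projective
line through any two distinct points of `Φ₀` meets `Φ₀` in exactly 3 points (i.e. it
contains exactly one further point of `Φ₀`). -/
theorem line_meets_flexScheme0_in_three_points (k : Type*) [Field k] [IsAlgClosed k]
    (h3 : (3 : k) ≠ 0) (P Q : ℙ k (Fin 3 → k)) (hP : P ∈ flexScheme0 k)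
    (hQ : Q ∈ flexScheme0 k) (hPQ : P ≠ Q) :
    {R : ℙ k (Fin 3 → k) | R ∈ flexScheme0 k ∧
      R.rep ∈ Submodule.span k ({P.rep, Q.rep} : Set (Fin 3 → k))}.ncard = 3 := by
  have hli : ∀ a b : k, a • P.rep + b • Q.rep = 0 → a = 0 ∧ b = 0 := by
    have h := Projectivization.independent_iff.mp
      ((Projectivization.independent_pair_iff_ne P Q).mpr hPQ)
    intro a b hab
    rw [Fintype.linearIndependent_iff] at h
    have h' := h ![a, b] (by simpa [Fin.sum_univ_two] using hab)
    exact ⟨h' 0, h' 1⟩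
  obtain ⟨c, hc, H⟩ := flex_line h3 P.rep Q.rep hP hQ hli
  have hr : P.rep + c • Q.rep ≠ 0 := by
    intro h
    have := hli 1 c (by simpa using h)
    simp at this
  have huniq : ∀ a b a' b' : k, a • P.rep + b • Q.rep = a' • P.rep + b' • Q.rep →
      a = a' ∧ b = b' := by
    intro a b a' b' h
    have := hli (a - a') (b - b') (by
      rw [sub_smul, sub_smul]
      linear_combination h)
    exact ⟨sub_eq_zero.mp this.1, sub_eq_zero.mp this.2⟩
  have hmk : ∀ (R S : ℙ k (Fin 3 → k)) (t : k), R.rep = t • S.rep → R = S := by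
    intro R S t h
    rw [← R.mk_rep, ← S.mk_rep, Projectivization.mk_eq_mk_iff']
    exact ⟨t, h.symm⟩
  set R₀ : ℙ k (Fin 3 → k) := Projectivization.mk k _ hr with hR₀
  obtain ⟨t, ht⟩ : ∃ t : k, t • (P.rep + c • Q.rep) = R₀.rep := by
    have h : Projectivization.mk k R₀.rep R₀.rep_nonzero = Projectivization.mk k _ hr := by
      rw [R₀.mk_rep]
    exact (Projectivization.mk_eq_mk_iff' k _ _ _ _).mp h
  have ht0 : t ≠ 0 := by
    rintro rfl
    exact R₀.rep_nonzero (by rw [← ht, zero_smul])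
  have ht' : R₀.rep = t • P.rep + (c * t) • Q.rep := by
    rw [← ht, smul_add, smul_smul, mul_comm]
  have hPR : P ≠ R₀ := by
    intro h
    have := huniq 1 0 t (c * t) (by rw [← ht', ← h]; simp)
    have h2 := this.2
    simp [hc, ht0] at h2
  have hQR : Q ≠ R₀ := by
    intro h
    have := huniq 0 1 t (c * t) (by rw [← ht', ← h]; simp)
    exact ht0 this.1.symm
  rw [Set.ncard_eq_three]
  refine ⟨P, Q, R₀, hPQ, hPR, hQR, ?_⟩
  ext R
  simp only [Set.mem_ofPred_eq, Set.mem_insert_iff, Set.mem_singleton_iff]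
  constructor
  · rintro ⟨hR, hs⟩
    obtain ⟨a, b, hab⟩ := Submodule.mem_span_pair.mp hs
    have hR' : R.rep 0 ^ 3 + R.rep 1 ^ 3 + R.rep 2 ^ 3 = 0 ∧
      R.rep 0 * R.rep 1 * R.rep 2 = 0 := hR
    rw [← hab, H] at hR'
    rcases hR' with rfl | rfl | rfl
    · exact Or.inr (Or.inl (hmk R Q b (by rw [← hab]; simp)))
    · exact Or.inl (hmk R P a (by rw [← hab]; simp))
    · refine Or.inr (Or.inr (hmk R R₀ (a / t) ?_))
      rw [← hab, ht', smul_add, smul_smul, smul_smul]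
      congr 2 <;> field_simp
  · rintro (rfl | rfl | rfl)
    · exact ⟨hP, Submodule.subset_span (by simp)⟩
    · exact ⟨hQ, Submodule.subset_span (by simp)⟩
    · refine ⟨?_, Submodule.mem_span_pair.mpr ⟨t, c * t, ht'.symm⟩⟩
      change R₀.rep 0 ^ 3 + R₀.rep 1 ^ 3 + R₀.rep 2 ^ 3 = 0 ∧
        R₀.rep 0 * R₀.rep 1 * R₀.rep 2 = 0
      rw [ht', H]
      simp

end
end
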